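/- arXiv:2511.12111 — 2 statements merged into one kernel-verified Lean document; each statement's English description precedes it below -/
import Mathlib

section
/- Let (M, d) be a metric space, g : M → M a map, Σ a nonempty subset of M × M, and x, y ∈ M. If the pair (x, y) is average separated for Σ (condition AS(Σ)), then the pair (x, y) is frequently separated for Σ (condition FS(Σ)). -/
open Filter Metric

open scoped Classical in
/-- Asymptotic upper density of a set of nonnegative integers. -/
noncomputable def upperDensity (A : Set ℕ) : ℝ :=
  Filter.limsup
    (fun n => (((Finset.range n).filter (fun i => i ∈ A)).card : ℝ) / n) Filter.atTop

/-- The pair `(x, y)` is frequently separated for `S` under the dynamics of `g`: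
for every `ε > 0` there is `δ > 0` such that the set of times `n` at which
`(g^n x, g^n y)` is at distance at least `δ` from `S` (in the sup metric on `M × M`)
has asymptotic upper density greater than `1 - ε`. -/
def FreqSep {M : Type*} [MetricSpace M] (g : M → M) (S : Set (M × M)) (x y : M) : Prop :=
  ∀ ε : ℝ, 0 < ε → ∃ δ : ℝ, 0 < δ ∧
    upperDensity {n : ℕ | δ ≤ Metric.infDist (g^[n] x, g^[n] y) S} > 1 - ε

/-- The term `max (-log d((gⁱ x, gⁱ y), S), 0)`, valued in `ℝ≥0∞`, with the convention
`-log 0 = +∞`. -/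
noncomputable def asTerm {M : Type*} [MetricSpace M] (g : M → M) (S : Set (M × M)) (x y : M)
    (i : ℕ) : ENNReal :=
  if Metric.infDist (g^[i] x, g^[i] y) S = 0 then ⊤
  else ENNReal.ofReal (max (-Real.log (Metric.infDist (g^[i] x, g^[i] y) S)) 0)

/-- The pair `(x, y)` is average separated for `S` under the dynamics of `g`:
`liminf_{n → ∞} (1/n) ∑_{i=0}^{n-1} max (-log d((gⁱ x, gⁱ y), S), 0) < +∞`. -/
def AvgSep {M : Type*} [MetricSpace M] (g : M → M) (S : Set (M × M)) (x y : M) : Prop :=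
  Filter.liminf
    (fun n : ℕ => (∑ i ∈ Finset.range n, asTerm g S x y i) / (n : ENNReal)) Filter.atTop < ⊤

/-- Times at which the orbit pair is closer than `exp (-K)` to `S` contribute at least `K`. -/
lemma ofReal_le_asTerm {M : Type*} [MetricSpace M] (g : M → M) (S : Set (M × M)) (x y : M)
    {K : ℝ} {i : ℕ} (hi : Metric.infDist (g^[i] x, g^[i] y) S < Real.exp (-K)) :
    ENNReal.ofReal K ≤ asTerm g S x y i := by
  unfold asTerm
  split_ifs with h0
  · exact le_top
  · have hpos : 0 < Metric.infDist (g^[i] x, g^[i] y) S :=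
      lt_of_le_of_ne Metric.infDist_nonneg (Ne.symm h0)
    have hlog := (Real.log_lt_iff_lt_exp hpos).2 hi
    exact ENNReal.ofReal_le_ofReal (le_max_of_le_left (by linarith))

open scoped Classical in
/-- A real number that is frequently a lower bound for the proportion of `A` in `[0, n)` is a
lower bound for the upper density of `A`. -/
lemma le_upperDensity_of_frequently_le {A : Set ℕ} {a : ℝ}
    (h : ∃ᶠ n : ℕ in atTop,
      a ≤ (((Finset.range n).filter (fun i => i ∈ A)).card : ℝ) / n) :
    a ≤ upperDensity A := by
  refine le_limsup_of_frequently_le h ?_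
  refine isBoundedUnder_of ⟨1, fun n => div_le_one_of_le₀ ?_ n.cast_nonneg⟩
  exact_mod_cast (Finset.card_filter_le _ _).trans (Finset.card_range n).le

/-- The average separated condition `AS(Σ)` implies the frequently separated condition
`FS(Σ)`. -/
theorem avgSep_implies_freqSep {M : Type*} [MetricSpace M] (g : M → M) (S : Set (M × M))
    (hS : S.Nonempty) (x y : M) (h : AvgSep g S x y) : FreqSep g S x y := by
  classical
  intro ε hε
  obtain ⟨c, hc, -⟩ := ENNReal.lt_iff_exists_nnreal_btwn.1 h
  have hfreq := frequently_lt_of_liminf_lt (by isBoundedDefault) hc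
  set K : ℝ := 2 * (c + 1) / ε with hK
  have hKpos : 0 < K := by positivity
  refine ⟨Real.exp (-K), Real.exp_pos _, ?_⟩
  suffices 1 - ε / 2 ≤ upperDensity
      {n : ℕ | Real.exp (-K) ≤ Metric.infDist (g^[n] x, g^[n] y) S} by linarith
  refine le_upperDensity_of_frequently_le
    ((hfreq.and_eventually (eventually_gt_atTop 0)).mono ?_)
  rintro n ⟨hn, hn0⟩
  set B := (Finset.range n).filter
    (fun i => i ∈ {n : ℕ | Real.exp (-K) ≤ Metric.infDist (g^[n] x, g^[n] y) S})
  have hn0' : (0 : ℝ) < n := by exact_mod_cast hn0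
  have hBsub : B ⊆ Finset.range n := Finset.filter_subset _ _
  have hcard : (((Finset.range n \ B).card : ℕ) : ℝ) + B.card = n := by
    exact_mod_cast (Finset.card_sdiff_add_card_eq_card hBsub).trans (Finset.card_range n)
  have hsum : ((Finset.range n \ B).card : ENNReal) * ENNReal.ofReal K
      ≤ ∑ i ∈ Finset.range n, asTerm g S x y i := by
    rw [← nsmul_eq_mul]
    refine (Finset.card_nsmul_le_sum _ _ _ fun i hi => ?_).trans
      (Finset.sum_le_sum_of_subset Finset.sdiff_subset)
    refine ofReal_le_asTerm g S x y (not_le.1 fun hle => ?_)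
    rw [Finset.mem_sdiff, Finset.mem_range] at hi
    exact hi.2 (Finset.mem_filter.2 ⟨Finset.mem_range.2 hi.1, hle⟩)
  have hle : ((Finset.range n \ B).card : ENNReal) * ENNReal.ofReal K ≤ c * n :=
    hsum.trans ((ENNReal.div_le_iff (by exact_mod_cast hn0.ne') (by simp)).1 hn.le)
  have hreal : ((Finset.range n \ B).card : ℝ) * K ≤ c * n := by
    simpa [hKpos.le] using ENNReal.toReal_mono (by finiteness) hle
  have hbad : ((Finset.range n \ B).card : ℝ) ≤ ε / 2 * n := by
    refine le_of_mul_le_mul_right (hreal.trans ?_) hKpos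
    have : ε / 2 * n * K = (c + 1) * n := by rw [hK]; field_simp
    rw [this]
    nlinarith
  rw [le_div_iff₀ hn0']
  linarith
end

section
/- Let μ, μ₁, μ₂ be Borel measures on the open unit disc 𝔻, each finite on compact subsets of 𝔻, such that μ₁ and μ₂ have positive total mass and μ₁({0}) = μ₂({0}) = 0. Let (ρ_n)_{n≥0} and (ρ'_n)_{n≥0} be sequences of real numbers in (0,1] and let (d_n)_{n≥0} be a sequence of positive real numbers. If d_n·[ρ_n]^*μ converges weakly to μ₁ and d_n·[ρ'_n]^*μ converges weakly to μ₂, then the sequences (ρ_n) and (ρ'_n) are equivalent, i.e. the sequence log(ρ_n/ρ'_n) is bounded. -/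
open MeasureTheory Metric Filter

/-- The pullback `[ρ]^*μ` of a Borel measure `μ` on the unit disc `𝔻 ⊆ ℂ` under the map
`[ρ] : t ↦ ρt`, realized as the pushforward under `z ↦ z/ρ` of the restriction of `μ` to the
disc of radius `ρ`; thus `([ρ]^*μ)(A) = μ({ρt : t ∈ A})` for `A ⊆ 𝔻`. -/
noncomputable def discPullback (ρ : ℝ) (μ : Measure ℂ) : Measure ℂ :=
  Measure.map (fun z : ℂ => z / (ρ : ℂ)) (μ.restrict (Metric.ball (0 : ℂ) ρ))

/-- Weak convergence of a sequence of Borel measures on the unit disc: the integrals converge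
for every continuous real-valued test function with compact support contained in the open
unit disc. -/
def WeakLimOnDisc (ν : ℕ → Measure ℂ) (ν' : Measure ℂ) : Prop :=
  ∀ f : ℂ → ℝ, Continuous f → HasCompactSupport f → tsupport f ⊆ Metric.ball (0 : ℂ) 1 →
    Tendsto (fun n => ∫ z, f z ∂(ν n)) atTop (nhds (∫ z, f z ∂ν'))

/-- A measure on the unit disc is finite on compact subsets of the disc. -/
def FiniteOnDiscCompacts (μ : Measure ℂ) : Prop :=
  ∀ K : Set ℂ, IsCompact K → K ⊆ Metric.ball (0 : ℂ) 1 → μ K < ⊤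

/-- A Borel measure supported on the open unit disc. -/
def SupportedOnDisc (μ : Measure ℂ) : Prop :=
  μ (Metric.ball (0 : ℂ) 1)ᶜ = 0

/-- A bounded continuous function supported in a compact subset of the disc is integrable. -/
lemma FiniteOnDiscCompacts.integrable_of_support_subset {μ : Measure ℂ}
    (hμ : FiniteOnDiscCompacts μ) {f : ℂ → ℝ} (hf : Continuous f) {C s : ℝ}
    (hC : ∀ z, |f z| ≤ C) (hs : s < 1) (hsupp : Function.support f ⊆ closedBall 0 s) :
    Integrable f μ := by
  rw [← integrableOn_iff_integrable_of_support_subset hsupp]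
  exact Measure.integrableOn_of_bounded
    (hμ _ (isCompact_closedBall 0 s) (closedBall_subset_ball hs)).ne
    hf.aestronglyMeasurable (Eventually.of_forall hC)

lemma ContDiffBump.integrable_of_finiteOnDiscCompacts {μ : Measure ℂ}
    (hμ : FiniteOnDiscCompacts μ) (f : ContDiffBump (0 : ℂ)) (hf : f.rOut < 1) :
    Integrable f μ :=
  hμ.integrable_of_support_subset f.continuous
    (fun _ => (abs_of_nonneg f.nonneg).trans_le f.le_one) hf
    (f.support_eq.trans_subset ball_subset_closedBall)

lemma norm_lt_of_contDiffBump_div_ne_zero (f : ContDiffBump (0 : ℂ)) {r : ℝ} (hr : 0 < r)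
    {z : ℂ} (hz : f (z / r) ≠ 0) : ‖z‖ < f.rOut * r := by
  have h : z / r ∈ Function.support f := hz
  rwa [f.support_eq, mem_ball_zero_iff, norm_div, Complex.norm_real, Real.norm_of_nonneg hr.le,
    div_lt_iff₀ hr] at h

lemma integral_contDiffBump_smul_discPullback (μ : Measure ℂ) (f : ContDiffBump (0 : ℂ))
    (hf : f.rOut < 1) {r d : ℝ} (hr : 0 < r) (hd : 0 ≤ d) :
    ∫ z, f z ∂(ENNReal.ofReal d • discPullback r μ) = d * ∫ z, f (z / r) ∂μ := by
  rw [integral_smul_measure, discPullback, integral_map (by fun_prop)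
    f.continuous.aestronglyMeasurable, ENNReal.toReal_ofReal hd, smul_eq_mul,
    setIntegral_eq_integral_of_forall_compl_eq_zero]
  intro z hz
  by_contra h
  refine hz (mem_ball_zero_iff.2 ((norm_lt_of_contDiffBump_div_ne_zero f hr h).trans ?_))
  nlinarith

lemma WeakLimOnDisc.tendsto_contDiffBump {ν : ℕ → Measure ℂ} {ν' : Measure ℂ}
    (h : WeakLimOnDisc ν ν') (f : ContDiffBump (0 : ℂ)) (hf : f.rOut < 1) :
    Tendsto (fun n => ∫ z, f z ∂(ν n)) atTop (nhds (∫ z, f z ∂ν')) :=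
  h f f.continuous f.hasCompactSupport (f.tsupport_eq.trans_subset (closedBall_subset_ball hf))

/-- A measure of positive mass on the disc has positive integral against some bump function. -/
lemma exists_contDiffBump_integral_pos {ν : Measure ℂ} (hfin : FiniteOnDiscCompacts ν)
    (hpos : 0 < ν (ball 0 1)) :
    ∃ f : ContDiffBump (0 : ℂ), f.rOut < 1 ∧ 0 < ∫ z, f z ∂ν := by
  obtain ⟨r, hr0, hr1, hr⟩ : ∃ r : ℝ, 0 < r ∧ r < 1 ∧ 0 < ν (closedBall 0 r) := by
    by_contra! h
    refine hpos.ne' (measure_mono_null (t := ⋃ n : ℕ, closedBall 0 (1 - 1 / ((n : ℝ) + 2))) ?_ ?_)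
    · intro z hz
      obtain ⟨n, hn⟩ := exists_nat_one_div_lt (sub_pos.2 (mem_ball_zero_iff.1 hz))
      refine Set.mem_iUnion.2 ⟨n, mem_closedBall_zero_iff.2 ?_⟩
      have : 1 / ((n : ℝ) + 2) ≤ 1 / ((n : ℝ) + 1) := by gcongr; norm_num
      linarith
    · refine measure_iUnion_null fun n => le_antisymm (h _ ?_ ?_) zero_le
      · rw [sub_pos, div_lt_one (by positivity)]
        linarith [(Nat.cast_nonneg n : (0 : ℝ) ≤ n)]
      · have : 0 < 1 / ((n : ℝ) + 2) := by positivity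
        linarith
  let f : ContDiffBump (0 : ℂ) := ⟨r, (1 + r) / 2, hr0, by linarith⟩
  have hf : f.rOut < 1 := by change (1 + r) / 2 < 1; linarith
  refine ⟨f, hf, ?_⟩
  rw [integral_pos_iff_support_of_nonneg (fun _ => f.nonneg)
    (f.integrable_of_finiteOnDiscCompacts hfin hf)]
  refine hr.trans_le (measure_mono fun z hz => ?_)
  rw [Function.mem_support, f.one_of_mem_closedBall hz]
  exact one_ne_zero

/-- A measure without atom at `0` has small integral against some bump function at `0`. -/
lemma exists_contDiffBump_integral_lt {ν : Measure ℂ} (hfin : FiniteOnDiscCompacts ν)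
    (hzero : ν {(0 : ℂ)} = 0) {c : ℝ} (hc : 0 < c) :
    ∃ g : ContDiffBump (0 : ℂ), g.rOut < 1 ∧ ∫ z, g z ∂ν < c := by
  have hlim := tendsto_measure_cthickening_of_isClosed (μ := ν) (s := {(0 : ℂ)})
    ⟨1 / 2, by norm_num, by
      rw [cthickening_singleton _ (by norm_num)]
      exact (hfin _ (isCompact_closedBall _ _) (closedBall_subset_ball (by norm_num))).ne⟩
    isClosed_singleton
  rw [hzero] at hlim
  have hev := (hlim.eventually (gt_mem_nhds (ENNReal.ofReal_pos.2 hc))).filter_mono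
    (nhdsWithin_le_nhds (s := Set.Ioi 0))
  obtain ⟨s, hs, hs0, hs1⟩ := (hev.and (Ioo_mem_nhdsGT (zero_lt_one' ℝ))).exists
  rw [cthickening_singleton _ hs0.le] at hs
  let g : ContDiffBump (0 : ℂ) := ⟨s / 2, s, by linarith, by linarith⟩
  have hg : g.rOut < 1 := hs1
  refine ⟨g, hg, lt_of_le_of_lt ?_ (ENNReal.toReal_lt_of_lt_ofReal hs)⟩
  have hsupp : Function.support g ⊆ closedBall 0 s :=
    g.support_eq.trans_subset ball_subset_closedBall
  have hlt := hfin _ (isCompact_closedBall (0 : ℂ) s) (closedBall_subset_ball hs1)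
  rw [← setIntegral_eq_integral_of_forall_compl_eq_zero
    (fun z hz => by_contra fun h => hz (hsupp h))]
  refine (setIntegral_mono_on (g.integrable_of_finiteOnDiscCompacts hfin hg).integrableOn
    (integrableOn_const hlt.ne) measurableSet_closedBall (fun _ _ => g.le_one)).trans_eq ?_
  simp [Measure.real]

/-- One rescaling sequence eventually dominates a multiple of the other. -/
lemma exists_eventually_mul_lt_of_weakLimOnDisc {μ μ₁ μ₂ : Measure ℂ}
    (hμfin : FiniteOnDiscCompacts μ) (hμ₁fin : FiniteOnDiscCompacts μ₁)
    (hμ₂fin : FiniteOnDiscCompacts μ₂) (hμ₁pos : 0 < μ₁ (ball (0 : ℂ) 1))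
    (hμ₂zero : μ₂ {(0 : ℂ)} = 0) {ρ ρ' : ℕ → ℝ} (hρ : ∀ n, 0 < ρ n)
    (hρ' : ∀ n, ρ' n ∈ Set.Ioc (0 : ℝ) 1) {d : ℕ → ℝ} (hd : ∀ n, 0 < d n)
    (h₁ : WeakLimOnDisc (fun n => ENNReal.ofReal (d n) • discPullback (ρ n) μ) μ₁)
    (h₂ : WeakLimOnDisc (fun n => ENNReal.ofReal (d n) • discPullback (ρ' n) μ) μ₂) :
    ∃ δ : ℝ, 0 < δ ∧ ∀ᶠ n in atTop, δ * ρ' n < ρ n := by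
  obtain ⟨f, hf, hfpos⟩ := exists_contDiffBump_integral_pos hμ₁fin hμ₁pos
  obtain ⟨g, hg, hglt⟩ := exists_contDiffBump_integral_lt hμ₂fin hμ₂zero hfpos
  refine ⟨g.rIn, g.rIn_pos, ?_⟩
  filter_upwards [(h₂.tendsto_contDiffBump g hg).eventually_lt (h₁.tendsto_contDiffBump f hf) hglt]
    with n hn
  obtain ⟨hρ'0, hρ'1⟩ := hρ' n
  rw [integral_contDiffBump_smul_discPullback μ g hg hρ'0 (hd n).le,
    integral_contDiffBump_smul_discPullback μ f hf (hρ n) (hd n).le,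
    mul_lt_mul_iff_right₀ (hd n)] at hn
  by_contra! hle
  refine hn.not_ge (integral_mono_of_nonneg (Eventually.of_forall fun _ => f.nonneg) ?_
    (Eventually.of_forall fun z => ?_))
  · refine hμfin.integrable_of_support_subset (g.continuous.comp (by fun_prop))
      (fun _ => (abs_of_nonneg g.nonneg).trans_le g.le_one) hg fun z hz => ?_
    rw [mem_closedBall_zero_iff]
    exact (norm_lt_of_contDiffBump_div_ne_zero g hρ'0 hz).le.trans
      (mul_le_of_le_one_right g.rOut_pos.le hρ'1)
  · by_cases hz : f (z / ρ n) = 0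
    · simpa only [hz] using g.nonneg
    · have hzlt := norm_lt_of_contDiffBump_div_ne_zero f (hρ n) hz
      have hone : g (z / ρ' n) = 1 := by
        refine g.one_of_mem_closedBall ?_
        rw [mem_closedBall_zero_iff, norm_div, Complex.norm_real, Real.norm_of_nonneg hρ'0.le,
          div_le_iff₀ hρ'0]
        nlinarith [hρ n]
      simpa only [hone] using f.le_one

/-- Uniqueness of rescaling factors: if `d_n·[ρ_n]^*μ → μ₁` and `d_n·[ρ'_n]^*μ → μ₂` weakly,
with `μ₁, μ₂` of positive mass and no atom at `0`, then the sequences `(ρ_n)` and `(ρ'_n)`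
are equivalent, i.e. `log (ρ_n / ρ'_n)` is bounded. -/
theorem rescaling_factors_unique_up_to_equivalence
    (μ μ₁ μ₂ : Measure ℂ)
    (hμD : SupportedOnDisc μ) (hμ₁D : SupportedOnDisc μ₁) (hμ₂D : SupportedOnDisc μ₂)
    (hμfin : FiniteOnDiscCompacts μ) (hμ₁fin : FiniteOnDiscCompacts μ₁)
    (hμ₂fin : FiniteOnDiscCompacts μ₂)
    (hμ₁pos : 0 < μ₁ (Metric.ball (0 : ℂ) 1)) (hμ₂pos : 0 < μ₂ (Metric.ball (0 : ℂ) 1))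
    (hμ₁zero : μ₁ {(0 : ℂ)} = 0) (hμ₂zero : μ₂ {(0 : ℂ)} = 0)
    (ρ ρ' : ℕ → ℝ) (hρ : ∀ n, ρ n ∈ Set.Ioc (0 : ℝ) 1) (hρ' : ∀ n, ρ' n ∈ Set.Ioc (0 : ℝ) 1)
    (dseq : ℕ → ℝ) (hd : ∀ n, 0 < dseq n)
    (h₁ : WeakLimOnDisc (fun n => ENNReal.ofReal (dseq n) • discPullback (ρ n) μ) μ₁)
    (h₂ : WeakLimOnDisc (fun n => ENNReal.ofReal (dseq n) • discPullback (ρ' n) μ) μ₂) :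
    ∃ B : ℝ, ∀ n, |Real.log (ρ n / ρ' n)| ≤ B := by
  obtain ⟨a, ha, hlow⟩ := exists_eventually_mul_lt_of_weakLimOnDisc hμfin hμ₁fin hμ₂fin hμ₁pos
    hμ₂zero (fun n => (hρ n).1) hρ' hd h₁ h₂
  obtain ⟨b, hb, hupp⟩ := exists_eventually_mul_lt_of_weakLimOnDisc hμfin hμ₂fin hμ₁fin hμ₂pos
    hμ₁zero (fun n => (hρ' n).1) hρ hd h₂ h₁
  have hbdd : IsBoundedUnder (· ≤ ·) atTop fun n => |Real.log (ρ n / ρ' n)| := by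
    refine ⟨max (-Real.log a) (-Real.log b), eventually_map.2 ?_⟩
    filter_upwards [hlow, hupp] with n hn hn'
    have h0 := (hρ n).1
    have h0' := (hρ' n).1
    have hla := Real.log_lt_log (mul_pos ha h0') hn
    have hlb := Real.log_lt_log (mul_pos hb h0) hn'
    rw [Real.log_mul ha.ne' h0'.ne'] at hla
    rw [Real.log_mul hb.ne' h0.ne'] at hlb
    rw [Real.log_div h0.ne' h0'.ne', abs_le]
    constructor
    · linarith [le_max_left (-Real.log a) (-Real.log b)]
    · linarith [le_max_right (-Real.log a) (-Real.log b)]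
  obtain ⟨B, hB⟩ := hbdd.bddAbove_range
  exact ⟨B, fun n => hB ⟨n, rfl⟩⟩
end
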